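/- arXiv:1201.0356 — 8 statements merged into one kernel-verified Lean document; each statement's English description precedes it below -/
import Mathlib

section
/- For every g ∈ GL₂(ℚ_p) there exist λ ∈ ℚ_p^×, t ∈ Γ₀(pℤ_p), nonnegative integers m, n, and a rational integer r such that either 0 ≤ r < p^{n+1} and g·λ·t equals the matrix [[p^m, 0],[r, p^n]], or 0 ≤ r < p^n and g·λ·t equals the matrix [[0, p^m],[p^n, r]] (where integer entries are interpreted in ℚ_p via the canonical ring map ℤ → ℚ_p). In particular, every coset of GL₂(ℚ_p) modulo ℚ_p^×·Γ₀(pℤ_p) contains a representative all of whose entries are rational integers. -/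
/-- `g` is an element of `GL₂(ℤ_p)` viewed inside `GL₂(ℚ_p)`. -/
def InGL2Zp {p : ℕ} [Fact p.Prime] (g : Matrix (Fin 2) (Fin 2) ℚ_[p]) : Prop :=
  (∀ i j, ∃ x : ℤ_[p], (x : ℚ_[p]) = g i j) ∧ ∃ u : ℤ_[p]ˣ, ((u : ℤ_[p]) : ℚ_[p]) = g.det

/-- `g ∈ Γ₀(pℤ_p)`. -/
def InGamma0 {p : ℕ} [Fact p.Prime] (g : Matrix (Fin 2) (Fin 2) ℚ_[p]) : Prop :=
  InGL2Zp g ∧ ∃ x : ℤ_[p], g 1 0 = (p : ℚ_[p]) * (x : ℚ_[p])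

theorem PadicInt.exists_int_eq_add_prime_pow_mul {p : ℕ} [Fact p.Prime] (x : ℤ_[p]) (n : ℕ) :
    ∃ (r : ℤ) (z : ℤ_[p]), 0 ≤ r ∧ r < (p : ℤ) ^ n ∧ (r : ℤ_[p]) = x + (p : ℤ_[p]) ^ n * z := by
  obtain ⟨y, hy⟩ := Ideal.mem_span_singleton.mp (PadicInt.appr_spec n x)
  refine ⟨x.appr n, -y, by positivity, mod_cast PadicInt.appr_lt x n, ?_⟩
  push_cast
  linear_combination -hy

/-- Two nonzero `p`-adic numbers can be simultaneously scaled to units times nonnegative powers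
of `p`, while making a third one integral. -/
theorem Padic.exists_common_scaling {p : ℕ} [Fact p.Prime] {a b : ℚ_[p]} (ha : a ≠ 0)
    (hb : b ≠ 0) (c : ℚ_[p]) :
    ∃ (l : ℚ_[p]) (u v : ℤ_[p]ˣ) (m n : ℕ) (x : ℤ_[p]), l ≠ 0 ∧
      l * a = (u : ℤ_[p]) * (p : ℚ_[p]) ^ m ∧ l * b = (v : ℤ_[p]) * (p : ℚ_[p]) ^ n ∧
      l * c = x := by
  classical
  obtain ⟨l, hl⟩ := IsLocalization.exist_integer_multiples_of_finset
    (nonZeroDivisors ℤ_[p]) ({a, b, c} : Finset ℚ_[p])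
  have hl0 : ((l : ℤ_[p]) : ℚ_[p]) ≠ 0 := by
    simp
  have int (y : ℚ_[p]) (hy : y ∈ ({a, b, c} : Finset ℚ_[p])) :
      ∃ x : ℤ_[p], ((l : ℤ_[p]) : ℚ_[p]) * y = x := by
    obtain ⟨x, hx⟩ := hl y hy
    exact ⟨x, by simpa [Algebra.smul_def] using hx.symm⟩
  have factor (y : ℚ_[p]) (hy : y ∈ ({a, b, c} : Finset ℚ_[p])) (hy0 : y ≠ 0) :
      ∃ (u : ℤ_[p]ˣ) (m : ℕ), ((l : ℤ_[p]) : ℚ_[p]) * y = (u : ℤ_[p]) * (p : ℚ_[p]) ^ m := by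
    obtain ⟨x, hx⟩ := int y hy
    have hx0 : x ≠ 0 := by
      rintro rfl
      exact mul_ne_zero hl0 hy0 (by simpa using hx)
    refine ⟨PadicInt.unitCoeff hx0, x.valuation, ?_⟩
    rw [hx]
    exact_mod_cast congrArg ((↑) : ℤ_[p] → ℚ_[p]) (PadicInt.unitCoeff_spec hx0)
  obtain ⟨u, m, hu⟩ := factor a (by simp) ha
  obtain ⟨v, n, hv⟩ := factor b (by simp) hb
  obtain ⟨x, hx⟩ := int c (by simp)
  exact ⟨_, u, v, m, n, x, hl0, hu, hv, hx⟩

theorem PadicInt.coe_inv_mul_coe {p : ℕ} [Fact p.Prime] (u : ℤ_[p]ˣ) :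
    ((↑(u⁻¹) : ℤ_[p]) : ℚ_[p]) * ((u : ℤ_[p]) : ℚ_[p]) = 1 := by
  exact_mod_cast congrArg ((↑) : ℤ_[p] → ℚ_[p]) u.inv_mul

theorem inGamma0_of_det_eq {p : ℕ} [Fact p.Prime] (x y z w : ℤ_[p]) (u : ℤ_[p]ˣ)
    (h : x * w - y * (p * z) = u) :
    InGamma0 !![(x : ℚ_[p]), (y : ℚ_[p]); (p : ℚ_[p]) * (z : ℚ_[p]), (w : ℚ_[p])] := by
  refine ⟨⟨?_, u, ?_⟩, z, by simp⟩
  · intro i j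
    fin_cases i <;> fin_cases j
    exacts [⟨x, by simp⟩, ⟨y, by simp⟩, ⟨p * z, by simp⟩, ⟨w, by simp⟩]
  · rw [← h, Matrix.det_fin_two_of]
    push_cast
    ring

/-- If the upper-right entry is divisible by the upper-left one, then right multiplication by
scalars and `Γ₀(pℤ_p)` reaches a lower triangular representative. -/
theorem exists_lower_triangular_rep {p : ℕ} [Fact p.Prime] (a c d : ℚ_[p]) (q : ℤ_[p])
    (hdet : a * d - a * q * c ≠ 0) :
    ∃ (lam : ℚ_[p]) (t : Matrix (Fin 2) (Fin 2) ℚ_[p]) (m n : ℕ) (r : ℤ),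
      lam ≠ 0 ∧ InGamma0 t ∧ 0 ≤ r ∧ r < (p : ℤ) ^ (n + 1) ∧
        !![a, a * q; c, d] * (lam • t) =
          !![(p : ℚ_[p]) ^ m, 0; (r : ℚ_[p]), (p : ℚ_[p]) ^ n] := by
  have ha : a ≠ 0 := by rintro rfl; simp at hdet
  have he : d - q * c ≠ 0 := fun h ↦ hdet (by linear_combination a * h)
  obtain ⟨l, u, v, m, n, x, hl, hu, hv, hx⟩ := Padic.exists_common_scaling ha he c
  obtain ⟨r, z, hr0, hr, hrz⟩ :=
    PadicInt.exists_int_eq_add_prime_pow_mul (x * (↑(u⁻¹) : ℤ_[p])) (n + 1)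
  have hrz' := congrArg ((↑) : ℤ_[p] → ℚ_[p]) hrz
  push_cast at hrz'
  have hu' := PadicInt.coe_inv_mul_coe u
  have hv' := PadicInt.coe_inv_mul_coe v
  refine ⟨l, _, m, n, r, hl, inGamma0_of_det_eq
    ((↑(u⁻¹) : ℤ_[p]) - q * (↑(v⁻¹) : ℤ_[p]) * (p : ℤ_[p]) * z) (-q * (↑(v⁻¹) : ℤ_[p]))
    ((↑(v⁻¹) : ℤ_[p]) * z) (↑(v⁻¹) : ℤ_[p]) (u⁻¹ * v⁻¹) ?_, hr0, hr, ?_⟩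
  · push_cast
    ring
  · generalize (↑(u⁻¹) : ℤ_[p]) = u' at *
    generalize (↑(v⁻¹) : ℤ_[p]) = v' at *
    ext i j
    fin_cases i <;> fin_cases j <;> simp [Matrix.mul_apply, Fin.sum_univ_two]
    · linear_combination (u' : ℚ_[p]) * hu + (p : ℚ_[p]) ^ m * hu'
    · ring
    · linear_combination (u' : ℚ_[p]) * hx + (v' * p * z : ℚ_[p]) * hv
        + (p : ℚ_[p]) ^ (n + 1) * z * hv' - hrz'
    · linear_combination (v' : ℚ_[p]) * hv + (p : ℚ_[p]) ^ n * hv'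

/-- If the upper-left entry is divisible by `p` times the upper-right one, then right
multiplication by scalars and `Γ₀(pℤ_p)` reaches a representative with vanishing upper-left
entry. -/
theorem exists_antitriangular_rep {p : ℕ} [Fact p.Prime] (b c d : ℚ_[p]) (q : ℤ_[p])
    (hdet : b * (p * q) * d - b * c ≠ 0) :
    ∃ (lam : ℚ_[p]) (t : Matrix (Fin 2) (Fin 2) ℚ_[p]) (m n : ℕ) (r : ℤ),
      lam ≠ 0 ∧ InGamma0 t ∧ 0 ≤ r ∧ r < (p : ℤ) ^ n ∧
        !![b * (p * q), b; c, d] * (lam • t) =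
          !![0, (p : ℚ_[p]) ^ m; (p : ℚ_[p]) ^ n, (r : ℚ_[p])] := by
  have hb : b ≠ 0 := by rintro rfl; simp at hdet
  have he : c - p * q * d ≠ 0 := fun h ↦ hdet (by linear_combination -b * h)
  obtain ⟨l, u, v, m, n, x, hl, hu, hv, hx⟩ := Padic.exists_common_scaling hb he d
  obtain ⟨r, z, hr0, hr, hrz⟩ :=
    PadicInt.exists_int_eq_add_prime_pow_mul (x * (↑(u⁻¹) : ℤ_[p])) n
  have hrz' := congrArg ((↑) : ℤ_[p] → ℚ_[p]) hrz
  push_cast at hrz'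
  have hu' := PadicInt.coe_inv_mul_coe u
  have hv' := PadicInt.coe_inv_mul_coe v
  refine ⟨l, _, m, n, r, hl, inGamma0_of_det_eq
    (↑(v⁻¹) : ℤ_[p]) ((↑(v⁻¹) : ℤ_[p]) * z) (-q * (↑(v⁻¹) : ℤ_[p]))
    ((↑(u⁻¹) : ℤ_[p]) - (p : ℤ_[p]) * q * (↑(v⁻¹) : ℤ_[p]) * z) (v⁻¹ * u⁻¹) ?_, hr0, hr, ?_⟩
  · push_cast
    ring
  · generalize (↑(u⁻¹) : ℤ_[p]) = u' at *
    generalize (↑(v⁻¹) : ℤ_[p]) = v' at *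
    ext i j
    fin_cases i <;> fin_cases j <;> simp [Matrix.mul_apply, Fin.sum_univ_two]
    · ring
    · linear_combination (u' : ℚ_[p]) * hu + (p : ℚ_[p]) ^ m * hu'
    · linear_combination (v' : ℚ_[p]) * hv + (p : ℚ_[p]) ^ n * hv'
    · linear_combination (u' : ℚ_[p]) * hx + (v' * z : ℚ_[p]) * hv
        + (p : ℚ_[p]) ^ n * z * hv' - hrz'

/-- Every `g ∈ GL₂(ℚ_p)` can be moved, by right multiplication by a scalar `λ ∈ ℚ_p^×`
and an element `t ∈ Γ₀(pℤ_p)`, to one of the standard integral representatives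
`[[p^m, 0],[r, p^n]]` with `0 ≤ r < p^(n+1)`, or `[[0, p^m],[p^n, r]]` with `0 ≤ r < p^n`.
In particular every coset of `ℚ_p^×·Γ₀(pℤ_p)` has a representative with rational
integer entries. -/
theorem exists_integral_rep_gamma0 (p : ℕ) [Fact p.Prime]
    (g : Matrix (Fin 2) (Fin 2) ℚ_[p]) (hg : IsUnit g.det) :
    ∃ (lam : ℚ_[p]) (t : Matrix (Fin 2) (Fin 2) ℚ_[p]) (m n : ℕ) (r : ℤ),
      lam ≠ 0 ∧ InGamma0 t ∧
      ((0 ≤ r ∧ r < (p : ℤ) ^ (n + 1) ∧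
          g * (lam • t) = !![(p : ℚ_[p]) ^ m, 0; (r : ℚ_[p]), (p : ℚ_[p]) ^ n]) ∨
        (0 ≤ r ∧ r < (p : ℤ) ^ n ∧
          g * (lam • t) = !![0, (p : ℚ_[p]) ^ m; (p : ℚ_[p]) ^ n, (r : ℚ_[p])])) := by
  have hdet := hg.ne_zero
  rw [Matrix.det_fin_two] at hdet
  rw [Matrix.eta_fin_two g]
  generalize g 0 0 = a, g 0 1 = b, g 1 0 = c, g 1 1 = d at *
  rcases le_or_gt ‖b‖ ‖a‖ with h | h
  · have ha : a ≠ 0 := by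
      rintro rfl
      simp_all
    obtain ⟨q, hq⟩ : ∃ q : ℤ_[p], a * q = b :=
      ⟨⟨b / a, by rw [norm_div]; exact div_le_one_of_le₀ h (norm_nonneg _)⟩,
        mul_div_cancel₀ b ha⟩
    subst hq
    obtain ⟨l, t, m, n, r, hl, ht, hr0, hr, heq⟩ := exists_lower_triangular_rep a c d q hdet
    exact ⟨l, t, m, n, r, hl, ht, .inl ⟨hr0, hr, heq⟩⟩
  · have hb : b ≠ 0 := norm_pos_iff.mp ((norm_nonneg a).trans_lt h)
    have hlt : ‖a / b‖ < 1 := by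
      rw [norm_div]
      exact (div_lt_one (norm_pos_iff.mpr hb)).mpr h
    obtain ⟨q, hq⟩ := (PadicInt.norm_lt_one_iff_dvd (⟨a / b, hlt.le⟩ : ℤ_[p])).mp hlt
    obtain rfl : b * (p * q) = a := by
      have := congrArg ((↑) : ℤ_[p] → ℚ_[p]) hq
      push_cast at this
      rw [← this, mul_div_cancel₀ a hb]
    obtain ⟨l, t, m, n, r, hl, ht, hr0, hr, heq⟩ := exists_antitriangular_rep b c d q hdet
    exact ⟨l, t, m, n, r, hl, ht, .inr ⟨hr0, hr, heq⟩⟩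
end

section
/- Let g = [[a,b],[c,d]] be a matrix with entries in ℤ_p and nonzero determinant, and suppose a ≠ 0 and that the p-adic valuation α of a satisfies α ≤ v_p(b) (where this condition is taken to hold automatically if b = 0). Set N = v_p(det g) − α (a nonnegative integer), and write a = r·p^α with r ∈ ℤ_p^×. Let c' ∈ ℤ_p be any element satisfying r·c' ≡ c (mod p^{N+1}ℤ_p), and set g' = [[p^α, 0],[c', p^N]]. Then g⁻¹·g' ∈ Γ₀(pℤ_p); in particular g and g' represent the same left coset of Γ₀(pℤ_p) in GL₂(ℚ_p). -/
theorem PadicInt.pow_dvd_of_le_valuation {p : ℕ} [Fact p.Prime] {x : ℤ_[p]} {n : ℕ}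
    (h : x = 0 ∨ n ≤ x.valuation) : (p : ℤ_[p]) ^ n ∣ x := by
  rcases eq_or_ne x 0 with rfl | hx
  · exact dvd_zero _
  · rw [PadicInt.unitCoeff_spec hx]
    exact dvd_mul_of_dvd_right (pow_dvd_pow _ (h.resolve_left hx)) _

/-- First reduction step of Lemma 1.2: if `g = [[a,b],[c,d]]` has entries in `ℤ_p`,
nonzero determinant, `a ≠ 0` with `a = r·p^α` (`r ∈ ℤ_p^×`), `α ≤ v_p(b)` (automatic if
`b = 0`), `N = v_p(det g) − α ≥ 0`, and `r·c' ≡ c (mod p^{N+1})`, then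
`g' = [[p^α, 0],[c', p^N]]` satisfies `g⁻¹·g' ∈ Γ₀(pℤ_p)`, i.e. `g·t = g'` for some
`t ∈ Γ₀(pℤ_p)`. -/
theorem gamma0_coset_rep_first_case (p : ℕ) [Fact p.Prime] (a b c d : ℤ_[p])
    (hdet : a * d - b * c ≠ 0) (ha : a ≠ 0)
    (α : ℕ) (r : ℤ_[p]ˣ) (hra : a = (r : ℤ_[p]) * (p : ℤ_[p]) ^ α)
    (hab : b = 0 ∨ (α : ℤ) ≤ b.valuation)
    (N : ℕ) (hN : (a * d - b * c).valuation = (α : ℤ) + (N : ℤ))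
    (c' : ℤ_[p]) (hc' : (p : ℤ_[p]) ^ (N + 1) ∣ ((r : ℤ_[p]) * c' - c)) :
    ∃ t : Matrix (Fin 2) (Fin 2) ℚ_[p], InGamma0 t ∧
      !![(a : ℚ_[p]), (b : ℚ_[p]); (c : ℚ_[p]), (d : ℚ_[p])] * t =
        !![(p : ℚ_[p]) ^ α, 0; (c' : ℚ_[p]), (p : ℚ_[p]) ^ N] := by
  have hp : (p : ℤ_[p]) ≠ 0 := PadicInt.prime_p.ne_zero
  obtain ⟨b', rfl⟩ : (p : ℤ_[p]) ^ α ∣ b :=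
    PadicInt.pow_dvd_of_le_valuation (hab.imp_right Nat.cast_le.mp)
  obtain ⟨k, hk⟩ := hc'
  have hval : (a * d - (p : ℤ_[p]) ^ α * b' * c).valuation = α + N := by exact_mod_cast hN
  set u := PadicInt.unitCoeff hdet
  have hu : (r : ℤ_[p]) * d - b' * c = u * (p : ℤ_[p]) ^ N := by
    have h := PadicInt.unitCoeff_spec hdet
    rw [hval] at h
    apply mul_left_cancel₀ (pow_ne_zero α hp)
    linear_combination h - d * hra
  have huu : (u : ℤ_[p]) * (u⁻¹ : ℤ_[p]ˣ) = 1 := u.mul_inv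
  have hrr : (r : ℤ_[p]) * (r⁻¹ : ℤ_[p]ˣ) = 1 := r.mul_inv
  set v : ℤ_[p] := ((u⁻¹ : ℤ_[p]ˣ) : ℤ_[p])
  set s : ℤ_[p] := ((r⁻¹ : ℤ_[p]ˣ) : ℤ_[p])
  set z : ℤ_[p] := p * (v * k) with hz
  set t : Matrix (Fin 2) (Fin 2) ℤ_[p] := !![s * (1 - b' * z), -(b' * v); z, r * v] with ht
  have htdet : t.det = v := by
    rw [ht, Matrix.det_fin_two_of]
    linear_combination v * (1 - b' * z) * hrr
  have hmul : !![a, (p : ℤ_[p]) ^ α * b'; c, d] * t =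
      !![(p : ℤ_[p]) ^ α, 0; c', (p : ℤ_[p]) ^ N] := by
    rw [ht, Matrix.mul_fin_two, hra]
    congr 1
    ext i j
    fin_cases i <;> fin_cases j <;> simp
    · linear_combination (p : ℤ_[p]) ^ α * (1 - b' * z) * hrr
    · ring
    · linear_combination (c' - d * z) * hrr + s * z * hu - s * hk + s * p ^ (N + 1) * k * huu
    · linear_combination v * hu + (p : ℤ_[p]) ^ N * huu
  have hcoe (x : ℤ_[p]) : PadicInt.Coe.ringHom x = (x : ℚ_[p]) := rfl
  refine ⟨t.map PadicInt.Coe.ringHom, ⟨⟨fun i j => ⟨t i j, rfl⟩, u⁻¹, ?_⟩, v * k, ?_⟩, ?_⟩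
  · rw [← RingHom.mapMatrix_apply, ← RingHom.map_det, htdet]
    rfl
  · simp [ht, hz, hcoe]
  · have h := congrArg (PadicInt.Coe.ringHom (p := p)).mapMatrix hmul
    rw [map_mul] at h
    convert h using 1
    · congr 1
      ext i j
      fin_cases i <;> fin_cases j <;> simp [hcoe]
    · ext i j
      fin_cases i <;> fin_cases j <;> simp [hcoe]
end

section
/- Let g = [[a,b],[c,d]] be a matrix with entries in ℤ_p and nonzero determinant, and suppose b ≠ 0 and that the p-adic valuation β of b satisfies β < v_p(a) (where this condition is taken to hold automatically if a = 0). Set N = v_p(det g) − β (a nonnegative integer), and write b = r·p^β with r ∈ ℤ_p^×. Let d' ∈ ℤ_p be any element satisfying r·d' ≡ d (mod p^{N}ℤ_p), and set g' = [[0, p^β],[p^N, d']]. Then g⁻¹·g' ∈ Γ₀(pℤ_p); in particular g and g' represent the same left coset of Γ₀(pℤ_p) in GL₂(ℚ_p). -/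
/-- Second reduction step of Lemma 1.2: if `g = [[a,b],[c,d]]` has entries in `ℤ_p`,
nonzero determinant, `b ≠ 0` with `b = r·p^β` (`r ∈ ℤ_p^×`), `β < v_p(a)` (automatic if
`a = 0`), `N = v_p(det g) − β ≥ 0`, and `r·d' ≡ d (mod p^N)`, then
`g' = [[0, p^β],[p^N, d']]` satisfies `g⁻¹·g' ∈ Γ₀(pℤ_p)`, i.e. `g·t = g'` for some
`t ∈ Γ₀(pℤ_p)`. -/
theorem gamma0_coset_rep_second_case (p : ℕ) [Fact p.Prime] (a b c d : ℤ_[p])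
    (hdet : a * d - b * c ≠ 0) (hb : b ≠ 0)
    (β : ℕ) (r : ℤ_[p]ˣ) (hrb : b = (r : ℤ_[p]) * (p : ℤ_[p]) ^ β)
    (hba : a = 0 ∨ (β : ℤ) < a.valuation)
    (N : ℕ) (hN : (a * d - b * c).valuation = (β : ℤ) + (N : ℤ))
    (d' : ℤ_[p]) (hd' : (p : ℤ_[p]) ^ N ∣ ((r : ℤ_[p]) * d' - d)) :
    ∃ t : Matrix (Fin 2) (Fin 2) ℚ_[p], InGamma0 t ∧
      !![(a : ℚ_[p]), (b : ℚ_[p]); (c : ℚ_[p]), (d : ℚ_[p])] * t =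
        !![0, (p : ℚ_[p]) ^ β; (p : ℚ_[p]) ^ N, (d' : ℚ_[p])] := by
  obtain ⟨e, he⟩ := hd'
  have hp : (p : ℤ_[p]) ≠ 0 := by exact_mod_cast (Fact.out : p.Prime).ne_zero
  have hpβ : (p : ℤ_[p]) ^ β ≠ 0 := pow_ne_zero _ hp
  obtain ⟨x, hx⟩ : ∃ x : ℤ_[p], a = p ^ β * (p * x) := by
    rcases hba with rfl | h
    · exact ⟨0, by simp⟩
    · have hle : β + 1 ≤ a.valuation := by omega
      obtain rfl | ha := eq_or_ne a 0
      · exact ⟨0, by simp⟩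
      · obtain ⟨y, hy⟩ : (p : ℤ_[p]) ^ (β + 1) ∣ a := by
          rw [PadicInt.unitCoeff_spec ha]
          exact (pow_dvd_pow _ hle).mul_left _
        exact ⟨y, by rw [hy]; ring⟩
  obtain ⟨w, hw⟩ : ∃ w : ℤ_[p]ˣ, a * d - b * c = w * p ^ (β + N) := by
    have hv : (a * d - b * c).valuation = β + N := by omega
    exact ⟨_, hv ▸ PadicInt.unitCoeff_spec hdet⟩
  have hw' : p * x * d - r * c = w * p ^ N := by
    apply mul_left_cancel₀ hpβ
    rw [hx, hrb, pow_add] at hw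
    linear_combination hw
  have hwi : (w : ℤ_[p]) * (w⁻¹ : ℤ_[p]ˣ) = 1 := w.mul_inv
  have hri : (r : ℤ_[p]) * (r⁻¹ : ℤ_[p]ˣ) = 1 := r.mul_inv
  generalize hv : ((w⁻¹ : ℤ_[p]ˣ) : ℤ_[p]) = v at hwi
  generalize ((r⁻¹ : ℤ_[p]ˣ) : ℤ_[p]) = s at hri
  have h00 : a * (-(r * v)) + b * (p * x * v) = 0 := by rw [hx, hrb]; ring
  have h01 : a * (-(e * v)) + b * (s * (1 + p * x * e * v)) = p ^ β := by
    rw [hx, hrb]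
    linear_combination (p : ℤ_[p]) ^ β * (1 + p * x * e * v) * hri
  have h10 : c * (-(r * v)) + d * (p * x * v) = p ^ N := by
    linear_combination v * hw' + (p : ℤ_[p]) ^ N * hwi
  have h11 : c * (-(e * v)) + d * (s * (1 + p * x * e * v)) = d' := by
    linear_combination s * e * v * hw' + s * e * p ^ N * hwi - s * he + (d' + c * e * v) * hri
  have hdt : -(r * v) * (s * (1 + p * x * e * v)) - -(e * v) * (p * x * v) = -v := by
    linear_combination -v * (1 + p * x * e * v) * hri
  refine ⟨!![((-(r * v) : ℤ_[p]) : ℚ_[p]), ((-(e * v) : ℤ_[p]) : ℚ_[p]);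
    ((p * x * v : ℤ_[p]) : ℚ_[p]), ((s * (1 + p * x * e * v) : ℤ_[p]) : ℚ_[p])],
    ⟨⟨?_, -w⁻¹, ?_⟩, x * v, ?_⟩, ?_⟩
  · intro i j
    fin_cases i <;> fin_cases j <;> exact ⟨_, rfl⟩
  · rw [Matrix.det_fin_two_of, Units.val_neg, hv, ← hdt]
    push_cast
    rfl
  · simp [mul_assoc]
  · rw [Matrix.mul_fin_two]
    simp only [← PadicInt.coe_mul, ← PadicInt.coe_add, h00, h01, h10, h11]
    simp
end

section
/- Let u, v ∈ GL₂(ℚ_p) with det u = p^a and det v = p^b for nonnegative integers a, b, and assume a + b = 2m for an integer m. Let u* denote the adjugate of u, so that u·u* = (det u)·I. Then for every z ∈ GL₂(ℚ_p) with det z = 1, the following are equivalent: (i) there exist λ ∈ ℚ_p^× and k ∈ GL₂(ℤ_p) with z = v·(λ·k)·u⁻¹; (ii) there exists a matrix x with entries in ℤ_p such that z = p^{−m}·v·x·u*. -/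
/-- Key identity for the `Γ`-equivalence problem: with `det u = p^a`, `det v = p^b`,
`a + b = 2m`, and `u*` the adjugate of `u`, a determinant-one matrix `z` satisfies
`z = v·(λ·k)·u⁻¹` for some `λ ∈ ℚ_p^×`, `k ∈ GL₂(ℤ_p)` (equivalently `z·u = v·(λ·k)`)
if and only if `z = p^{−m}·v·x·u*` (equivalently `p^m·z = v·x·u*`) for some matrix `x`
with entries in `ℤ_p`. -/
theorem vertex_hom_iff_integral_matrix (p : ℕ) [Fact p.Prime]
    (u v : Matrix (Fin 2) (Fin 2) ℚ_[p]) (a b m : ℕ)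
    (hu : u.det = (p : ℚ_[p]) ^ a) (hv : v.det = (p : ℚ_[p]) ^ b)
    (hm : a + b = 2 * m)
    (z : Matrix (Fin 2) (Fin 2) ℚ_[p]) (hz : z.det = 1) :
    (∃ (lam : ℚ_[p]) (k : Matrix (Fin 2) (Fin 2) ℚ_[p]),
        lam ≠ 0 ∧ InGL2Zp k ∧ z * u = v * (lam • k)) ↔
      (∃ x : Matrix (Fin 2) (Fin 2) ℤ_[p],
        ((p : ℚ_[p]) ^ m) • z = v * (x.map (fun y : ℤ_[p] => (y : ℚ_[p]))) * u.adjugate) := by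
  have hp : (p : ℚ_[p]) ≠ 0 := Nat.cast_ne_zero.2 (Fact.out : p.Prime).ne_zero
  have hpa : (p : ℚ_[p]) ^ a ≠ 0 := pow_ne_zero _ hp
  have hpb : (p : ℚ_[p]) ^ b ≠ 0 := pow_ne_zero _ hp
  have hpm : (p : ℚ_[p]) ^ m ≠ 0 := pow_ne_zero _ hp
  have hsq : (p : ℚ_[p]) ^ m * (p : ℚ_[p]) ^ m = (p : ℚ_[p]) ^ a * (p : ℚ_[p]) ^ b := by
    rw [← pow_add, ← pow_add, hm, two_mul]
  constructor
  · rintro ⟨lam, k, -, ⟨hk, d, hd⟩, h⟩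
    have hdet := congrArg Matrix.det h
    rw [Matrix.det_mul, Matrix.det_mul, Matrix.det_smul, hz, hu, hv, Fintype.card_fin, ← hd,
      one_mul] at hdet
    set c : ℚ_[p] := (p : ℚ_[p]) ^ m * lam / (p : ℚ_[p]) ^ a with hc
    have hcd : c ^ 2 * ((d : ℤ_[p]) : ℚ_[p]) = 1 := by
      rw [hc]
      field_simp
      linear_combination lam ^ 2 * ((d : ℤ_[p]) : ℚ_[p]) * hsq - (p : ℚ_[p]) ^ a * hdet
    have hcn : ‖c‖ ≤ 1 := by
      have hn := congrArg norm hcd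
      rw [norm_mul, norm_pow, ← PadicInt.norm_def, PadicInt.norm_units, mul_one, norm_one] at hn
      exact (pow_le_one_iff_of_nonneg (norm_nonneg c) two_ne_zero).1 hn.le
    obtain ⟨e, he⟩ : ∃ e : ℤ_[p], (e : ℚ_[p]) = c := ⟨⟨c, hcn⟩, rfl⟩
    choose y hy using hk
    refine ⟨Matrix.of fun i j => e * y i j, ?_⟩
    have hx : (Matrix.of fun i j => e * y i j).map
        (fun y : ℤ_[p] => (y : ℚ_[p])) = c • k := by
      ext i j
      simp [he, hy]
    have hzk : (p : ℚ_[p]) ^ a • z = lam • (v * k * u.adjugate) := by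
      rw [← hu, ← mul_one z, ← Matrix.mul_smul, ← Matrix.mul_adjugate, ← mul_assoc, h]
      simp
    rw [hx, Matrix.mul_smul, Matrix.smul_mul, hc, mul_div_right_comm, mul_smul, ← hzk, smul_smul,
      div_mul_cancel₀ _ hpa]
  · rintro ⟨x, h⟩
    set k := x.map (fun y : ℤ_[p] => (y : ℚ_[p]))
    have hk : k.det = 1 := by
      have hdet := congrArg Matrix.det h
      rw [Matrix.det_mul, Matrix.det_mul, Matrix.det_smul, Matrix.det_adjugate, hz, hu, hv,
        Fintype.card_fin, mul_one, pow_one, sq, hsq] at hdet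
      exact mul_left_cancel₀ (mul_ne_zero hpa hpb) (by linear_combination -hdet)
    refine ⟨(p : ℚ_[p]) ^ a / (p : ℚ_[p]) ^ m, k, div_ne_zero hpa hpm,
      ⟨fun i j => ⟨x i j, rfl⟩, 1, by simp [hk]⟩, ?_⟩
    have hzu : (p : ℚ_[p]) ^ m • (z * u) = (p : ℚ_[p]) ^ a • (v * k) := by
      rw [← Matrix.smul_mul, h, mul_assoc, Matrix.adjugate_mul, hu]
      simp
    rw [Matrix.mul_smul, div_eq_inv_mul, mul_smul, ← hzu, smul_smul, inv_mul_cancel₀ hpm, one_smul]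
end

section
/- For every g ∈ GL₂(ℚ_p) there exist λ ∈ ℚ_p^×, k ∈ GL₂(ℤ_p), and a nonnegative integer m such that every entry of the matrix g·λ·k is a rational integer (i.e., lies in the image of the canonical ring map ℤ → ℚ_p) and det(g·λ·k) = p^m. In particular, every coset of GL₂(ℚ_p) modulo ℚ_p^×·GL₂(ℤ_p) contains a representative with rational-integer entries. -/
open Matrix in
/-- Hermite normal form by column operations, when the top-left entry divides the top-right one. -/
theorem PadicInt.exists_mul_eq_int_of_dvd {p : ℕ} [Fact p.Prime]
    (h : Matrix (Fin 2) (Fin 2) ℤ_[p]) (hdet : h.det ≠ 0) (hdvd : h 0 0 ∣ h 0 1) :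
    ∃ (k : Matrix (Fin 2) (Fin 2) ℤ_[p]) (T : Matrix (Fin 2) (Fin 2) ℤ) (m : ℕ),
      IsUnit k.det ∧ h * k = T.map (Int.castRingHom ℤ_[p]) ∧ T.det = (p : ℤ) ^ m := by
  obtain ⟨q, hq⟩ := hdvd
  have hdet_eq : h.det = h 0 0 * (h 1 1 - h 1 0 * q) := by rw [det_fin_two, hq]; ring
  rw [hdet_eq] at hdet
  have hx := left_ne_zero_of_mul hdet
  have hd := right_ne_zero_of_mul hdet
  have hxu := PadicInt.unitCoeff_spec hx
  have hdv := PadicInt.unitCoeff_spec hd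
  set u := PadicInt.unitCoeff hx
  set v := PadicInt.unitCoeff hd
  set a := (h 0 0).valuation
  set b := (h 1 1 - h 1 0 * q).valuation
  have hu : (u : ℤ_[p]) * ↑u⁻¹ = 1 := u.mul_inv
  have hv : (v : ℤ_[p]) * ↑v⁻¹ = 1 := v.mul_inv
  set u' : ℤ_[p] := ↑u⁻¹
  set v' : ℤ_[p] := ↑v⁻¹
  obtain ⟨t, ht⟩ := Ideal.mem_span_singleton.mp (PadicInt.appr_spec b (h 1 0 * u'))
  refine ⟨!![u' + t * q * v', -(q * v'); -(t * v'), v'],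
    !![(p : ℤ) ^ a, 0; ((h 1 0 * u').appr b : ℤ), (p : ℤ) ^ b], a + b, ?_, ?_, ?_⟩
  · rw [det_fin_two_of, show (u' + t * q * v') * v' - -(q * v') * -(t * v') = u' * v' by ring]
    exact (u⁻¹).isUnit.mul (v⁻¹).isUnit
  · ext i j
    fin_cases i <;> fin_cases j <;>
      simp only [Fin.zero_eta, Fin.mk_one, mul_apply, Fin.sum_univ_two, map_apply, of_apply,
        cons_val', cons_val_zero, cons_val_one, cons_val_fin_one, hq, map_pow, map_natCast, map_zero]
    · linear_combination u' * hxu + (p : ℤ_[p]) ^ a * hu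
    · ring
    · linear_combination ht - t * v' * hdv - t * (p : ℤ_[p]) ^ b * hv
    · linear_combination v' * hdv + (p : ℤ_[p]) ^ b * hv
  · rw [det_fin_two_of]; ring

open Matrix in
/-- Every nonsingular `2 × 2` matrix over `ℤ_p` is right equivalent under `GL₂(ℤ_p)` to a matrix of
rational integers whose determinant is a power of `p`. -/
theorem PadicInt.exists_mul_eq_int {p : ℕ} [Fact p.Prime]
    (h : Matrix (Fin 2) (Fin 2) ℤ_[p]) (hdet : h.det ≠ 0) :
    ∃ (k : Matrix (Fin 2) (Fin 2) ℤ_[p]) (T : Matrix (Fin 2) (Fin 2) ℤ) (m : ℕ),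
      IsUnit k.det ∧ h * k = T.map (Int.castRingHom ℤ_[p]) ∧ T.det = (p : ℤ) ^ m := by
  obtain hdvd | hdvd := ValuationRing.dvd_total (h 0 0) (h 0 1)
  · exact PadicInt.exists_mul_eq_int_of_dvd h hdet hdvd
  · have hs : (!![0, 1; 1, 0] : Matrix (Fin 2) (Fin 2) ℤ_[p]).det = -1 := by
      simp [det_fin_two_of]
    obtain ⟨k, T, m, hk, hT, hm⟩ :=
      PadicInt.exists_mul_eq_int_of_dvd (h * !![0, 1; 1, 0])
        (by rw [det_mul, hs]; simpa using hdet)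
        (by simpa [mul_apply, Fin.sum_univ_two] using hdvd)
    refine ⟨!![0, 1; 1, 0] * k, T, m, ?_, by rw [← Matrix.mul_assoc, hT], hm⟩
    rw [det_mul, hs]
    simpa using hk

/-- Every coset of `GL₂(ℚ_p)` modulo `ℚ_p^×·GL₂(ℤ_p)` has a representative `g·λ·k`
all of whose entries are rational integers and whose determinant is `p^m` for some
`m ≥ 0`. -/
theorem exists_integral_rep_gl2 (p : ℕ) [Fact p.Prime]
    (g : Matrix (Fin 2) (Fin 2) ℚ_[p]) (hg : IsUnit g.det) :
    ∃ (lam : ℚ_[p]) (k : Matrix (Fin 2) (Fin 2) ℚ_[p]) (m : ℕ),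
      lam ≠ 0 ∧ InGL2Zp k ∧
      (∀ i j, ∃ r : ℤ, ((r : ℚ_[p]) = (g * (lam • k)) i j)) ∧
      (g * (lam • k)).det = (p : ℚ_[p]) ^ m := by
  obtain ⟨b, hb⟩ := IsLocalization.exist_integer_multiples_of_finite (nonZeroDivisors ℤ_[p])
    fun ij : Fin 2 × Fin 2 => g ij.1 ij.2
  have hb0 : ((b : ℤ_[p]) : ℚ_[p]) ≠ 0 := by
    simp
  choose h' hh' using hb
  set φ : ℤ_[p] →+* ℚ_[p] := algebraMap ℤ_[p] ℚ_[p]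
  set h : Matrix (Fin 2) (Fin 2) ℤ_[p] := Matrix.of fun i j => h' (i, j)
  have hh : h.map φ = ((b : ℤ_[p]) : ℚ_[p]) • g := by
    ext i j
    exact (hh' (i, j)).trans (Algebra.smul_def _ _)
  have hdet : h.det ≠ 0 := by
    intro h0
    have hφ : (h.map φ).det = 0 := by
      rw [← RingHom.mapMatrix_apply, ← RingHom.map_det, h0, map_zero]
    rw [hh, Matrix.det_smul] at hφ
    exact mul_ne_zero (pow_ne_zero _ hb0) hg.ne_zero hφ
  obtain ⟨k, T, m, hk, hT, hm⟩ := PadicInt.exists_mul_eq_int h hdet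
  have key : g * (((b : ℤ_[p]) : ℚ_[p]) • k.map φ) = T.map (Int.castRingHom ℚ_[p]) := by
    rw [Matrix.mul_smul, ← Matrix.smul_mul, ← hh, ← Matrix.map_mul, hT]
    ext i j
    simp
  refine ⟨(b : ℤ_[p]), k.map φ, m, hb0, ⟨fun i j => ⟨k i j, rfl⟩, hk.unit, ?_⟩,
    fun i j => ⟨T i j, ?_⟩, ?_⟩
  · rw [← RingHom.mapMatrix_apply, ← RingHom.map_det]
    rfl
  · rw [key]
    rfl
  · rw [key, ← RingHom.mapMatrix_apply, ← RingHom.map_det, hm]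
    simp
end

section
/- Let p be a prime. The set of ℤ_p-submodules M of the free module ℤ_p² (= Fin 2 → ℤ_p) satisfying the strict inclusions p·ℤ_p² ⊊ M ⊊ ℤ_p² has exactly p + 1 elements. (Consequently, every vertex of the Bruhat–Tits tree for GL₂(ℚ_p) has exactly p + 1 neighbours.) -/
/-- Coordinatewise reduction modulo `p`, as a semilinear map `ℤ_p^ι → 𝔽_p^ι`. -/
noncomputable def PadicInt.piToZMod (p : ℕ) [Fact p.Prime] (ι : Type*) :
    (ι → ℤ_[p]) →ₛₗ[(PadicInt.toZMod : ℤ_[p] →+* ZMod p)] (ι → ZMod p) where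
  toFun v i := PadicInt.toZMod (v i)
  map_add' v w := by ext i; simp
  map_smul' c v := by ext i; simp

theorem PadicInt.toZMod_surjective (p : ℕ) [Fact p.Prime] :
    Function.Surjective (PadicInt.toZMod : ℤ_[p] →+* ZMod p) :=
  ZMod.ringHom_surjective _

theorem PadicInt.piToZMod_surjective (p : ℕ) [Fact p.Prime] (ι : Type*) :
    Function.Surjective (PadicInt.piToZMod p ι) := fun w ↦ by
  choose v hv using fun i ↦ PadicInt.toZMod_surjective p (w i)
  exact ⟨v, funext hv⟩

open Pointwise in
theorem PadicInt.ker_piToZMod (p : ℕ) [Fact p.Prime] (ι : Type*) :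
    LinearMap.ker (PadicInt.piToZMod p ι) =
      (p : ℤ_[p]) • (⊤ : Submodule ℤ_[p] (ι → ℤ_[p])) := by
  ext v
  have hcoord (x : ℤ_[p]) : PadicInt.toZMod x = 0 ↔ ∃ y, (p : ℤ_[p]) * y = x := by
    rw [← RingHom.mem_ker, PadicInt.ker_toZMod, PadicInt.maximalIdeal_eq_span_p,
      Ideal.mem_span_singleton, dvd_def]
    simp only [eq_comm]
  have hker : v ∈ LinearMap.ker (PadicInt.piToZMod p ι) ↔ ∀ i, PadicInt.toZMod (v i) = 0 :=
    LinearMap.mem_ker.trans funext_iff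
  rw [hker, Submodule.mem_smul_pointwise_iff_exists]
  simp only [hcoord, Submodule.mem_top, true_and, Classical.skolem, funext_iff, Pi.smul_apply,
    smul_eq_mul]

/-- In a plane, the proper nonzero subspaces are the lines. -/
theorem Submodule.bot_lt_and_lt_top_iff_finrank_eq_one {K V : Type*} [Field K] [AddCommGroup V]
    [Module K V] (hV : Module.finrank K V = 2) (W : Submodule K V) :
    (⊥ < W ∧ W < ⊤) ↔ Module.finrank K W = 1 := by
  have : FiniteDimensional K V := Module.finite_of_finrank_eq_succ hV
  constructor
  · rintro ⟨hbot, htop⟩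
    have h0 := Submodule.finrank_lt_finrank_of_lt hbot
    have h2 := Submodule.finrank_lt htop.ne
    rw [finrank_bot] at h0
    omega
  · intro h
    refine ⟨bot_lt_iff_ne_bot.2 ?_, lt_top_iff_ne_top.2 ?_⟩
    · rintro rfl
      simp at h
    · rintro rfl
      rw [finrank_top] at h
      omega

theorem Submodule.ncard_bot_lt_and_lt_top {K V : Type*} [Field K] [Finite K] [AddCommGroup V]
    [Module K V] (hV : Module.finrank K V = 2) :
    Set.ncard {W : Submodule K V | ⊥ < W ∧ W < ⊤} = Nat.card K + 1 := by
  simp only [Submodule.bot_lt_and_lt_top_iff_finrank_eq_one hV]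
  rw [← Projectivization.card_of_finrank_two K V hV, ← Nat.card_coe_set_eq]
  exact Nat.card_congr (Projectivization.equivSubmodule K V).symm

/-- The submodules strictly between the kernel of a surjective semilinear map and the whole module
are the preimages of the proper nonzero submodules of the target. -/
theorem Submodule.image_comap_bot_lt_and_lt_top {R S M N : Type*} [Ring R] [Ring S]
    [AddCommGroup M] [AddCommGroup N] [Module R M] [Module S N] {σ : R →+* S}
    [RingHomSurjective σ] (f : M →ₛₗ[σ] N) (hf : Function.Surjective f) :
    Submodule.comap f '' {W | ⊥ < W ∧ W < ⊤} = {L | LinearMap.ker f < L ∧ L < ⊤} := by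
  have hmono : StrictMono (Submodule.comap f) :=
    (Submodule.giMapComap hf).strictMono_u
  ext L
  constructor
  · rintro ⟨W, ⟨hbot, htop⟩, rfl⟩
    exact ⟨hmono hbot, hmono htop⟩
  · rintro ⟨hker, htop⟩
    have hL : Submodule.comap f (Submodule.map f L) = L := by
      rw [Submodule.comap_map_eq, sup_eq_left.2 hker.le]
    refine ⟨Submodule.map f L, ⟨bot_lt_iff_ne_bot.2 fun h ↦ ?_, lt_top_iff_ne_top.2 fun h ↦ ?_⟩, hL⟩
    · rw [h] at hL
      exact hker.ne hL
    · rw [h, Submodule.comap_top] at hL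
      exact htop.ne hL.symm

open Pointwise in
/-- The number of `ℤ_p`-submodules `M` of `ℤ_p²` with `p·ℤ_p² ⊊ M ⊊ ℤ_p²` is exactly
`p + 1`: every vertex of the Bruhat–Tits tree for `GL₂(ℚ_p)` has `p + 1` neighbours. -/
theorem card_intermediate_submodules (p : ℕ) [Fact p.Prime] :
    Set.ncard {M : Submodule ℤ_[p] (Fin 2 → ℤ_[p]) |
      (p : ℤ_[p]) • (⊤ : Submodule ℤ_[p] (Fin 2 → ℤ_[p])) < M ∧ M < ⊤} = p + 1 := by
  have : RingHomSurjective (PadicInt.toZMod : ℤ_[p] →+* ZMod p) :=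
    ⟨PadicInt.toZMod_surjective p⟩
  have hf := PadicInt.piToZMod_surjective p (Fin 2)
  rw [← PadicInt.ker_piToZMod, ← Submodule.image_comap_bot_lt_and_lt_top _ hf,
    Set.ncard_image_of_injective _ (Submodule.comap_injective_of_surjective hf),
    Submodule.ncard_bot_lt_and_lt_top (by simp), Nat.card_zmod]
end

section
/- Let Λ₀ ⊆ ℚ_p² denote the ℤ_p-span of the standard basis vectors e₁, e₂, and let Λ₁ ⊆ ℚ_p² denote the ℤ_p-span of e₁ and p·e₂. For g ∈ GL₂(ℚ_p), let g·Λ denote the image of a submodule Λ under the linear map x ↦ g·x. Then the following are equivalent: (i) there exist λ, μ ∈ ℚ_p^× with g·Λ₀ = λ·Λ₀ and g·Λ₁ = μ·Λ₁; (ii) g = ν·t for some ν ∈ ℚ_p^× and t ∈ Γ₀(pℤ_p). In other words, the stabilizer in GL₂(ℚ_p) of the ordered edge (v₀, v₁) of the Bruhat–Tits tree is exactly ℚ_p^×·Γ₀(pℤ_p). -/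
/-- The standard lattice `Λ₀ ⊆ ℚ_p²`: the `ℤ_p`-span of the standard basis vectors
`e₁, e₂`. -/
noncomputable def stdLattice (p : ℕ) [Fact p.Prime] : Submodule ℤ_[p] (Fin 2 → ℚ_[p]) :=
  Submodule.span ℤ_[p] (Set.range fun i : Fin 2 => (Pi.single i 1 : Fin 2 → ℚ_[p]))

/-- The lattice `Λ₁ ⊆ ℚ_p²`: the `ℤ_p`-span of `e₁` and `p·e₂`. -/
noncomputable def stdLattice' (p : ℕ) [Fact p.Prime] : Submodule ℤ_[p] (Fin 2 → ℚ_[p]) :=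
  Submodule.span ℤ_[p]
    ({Pi.single 0 1, Pi.single 1 (p : ℚ_[p])} : Set (Fin 2 → ℚ_[p]))

open Matrix in
/-- Conjugating and rescaling: `g` maps the lattice `D S` to `c D S` iff `c⁻¹ D⁻¹ g D`
preserves `S`. -/
theorem mulVec_image_eq_smul_image_iff {n K : Type*} [Fintype n] [DecidableEq n] [Field K]
    (g D E : Matrix n n K) (hED : E * D = 1) {c : K} (hc : c ≠ 0) (S : Set (n → K)) :
    g.mulVec '' (D.mulVec '' S) = (fun x => c • x) '' (D.mulVec '' S) ↔
      (c⁻¹ • (E * g * D)).mulVec '' S = S := by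
  have hDE : D * E = 1 := mul_eq_one_comm.mp hED
  have hinj : Function.Injective fun x : n → K => c⁻¹ • E.mulVec x := by
    intro x y hxy
    have h := congrArg D.mulVec (smul_right_injective _ (inv_ne_zero hc) hxy)
    simpa [mulVec_mulVec, hDE] using h
  rw [← (Set.image_injective.mpr hinj).eq_iff]
  simp only [Set.image_image]
  have h₁ : ∀ x, c⁻¹ • E.mulVec (g.mulVec (D.mulVec x)) = (c⁻¹ • (E * g * D)).mulVec x := by
    intro x
    simp [mulVec_mulVec, smul_mulVec, mul_assoc]
  have h₂ : ∀ x, c⁻¹ • E.mulVec (c • D.mulVec x) = x := by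
    intro x
    rw [mulVec_smul, mulVec_mulVec, hED, one_mulVec, inv_smul_smul₀ hc]
  simp only [h₁, h₂, Set.image_id']

section Lattice

variable {p : ℕ} [Fact p.Prime]

theorem mem_stdLattice_iff {x : Fin 2 → ℚ_[p]} :
    x ∈ stdLattice p ↔ ∀ i, ‖x i‖ ≤ 1 := by
  rw [stdLattice, Submodule.mem_span_range_iff_exists_fun]
  constructor
  · rintro ⟨c, rfl⟩ i
    fin_cases i <;> simp [Algebra.smul_def, PadicInt.norm_le_one]
  · intro h
    have hlift : ∀ i, ∃ a : ℤ_[p], (a : ℚ_[p]) = x i := fun i => ⟨⟨x i, h i⟩, rfl⟩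
    choose a ha using hlift
    refine ⟨a, ?_⟩
    ext i
    fin_cases i <;> simp [Algebra.smul_def, ha]

theorem stdLattice'_eq_image :
    (stdLattice' p : Set (Fin 2 → ℚ_[p])) =
      (Matrix.diagonal ![1, (p : ℚ_[p])]).mulVec '' (stdLattice p : Set (Fin 2 → ℚ_[p])) := by
  ext x
  simp only [stdLattice', SetLike.mem_coe, Submodule.mem_span_pair, Set.mem_image,
    mem_stdLattice_iff]
  constructor
  · rintro ⟨a, b, rfl⟩
    refine ⟨![a, b], fun i => ?_, ?_⟩
    · fin_cases i <;> simp [PadicInt.norm_le_one]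
    · ext i
      fin_cases i <;> simp [Matrix.mulVec_diagonal, Algebra.smul_def, mul_comm]
  · rintro ⟨y, hy, rfl⟩
    have hlift : ∀ i, ∃ a : ℤ_[p], (a : ℚ_[p]) = y i := fun i => ⟨⟨y i, hy i⟩, rfl⟩
    choose a ha using hlift
    refine ⟨a 0, a 1, ?_⟩
    ext i
    fin_cases i <;> simp [Matrix.mulVec_diagonal, Algebra.smul_def, ha, mul_comm]

theorem inGL2Zp_iff_norm {g : Matrix (Fin 2) (Fin 2) ℚ_[p]} :
    InGL2Zp g ↔ (∀ i j, ‖g i j‖ ≤ 1) ∧ ‖g.det‖ = 1 := by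
  refine and_congr (forall₂_congr fun i j => ?_) ?_
  · exact ⟨fun ⟨x, hx⟩ => hx ▸ x.norm_le_one, fun h => ⟨⟨_, h⟩, rfl⟩⟩
  · constructor
    · rintro ⟨u, hu⟩
      rw [← hu, ← PadicInt.norm_def]
      exact PadicInt.norm_units u
    · intro h
      exact ⟨PadicInt.mkUnits h, rfl⟩

theorem norm_mulVec_le_one {g : Matrix (Fin 2) (Fin 2) ℚ_[p]} (hg : ∀ i j, ‖g i j‖ ≤ 1)
    {x : Fin 2 → ℚ_[p]} (hx : ∀ i, ‖x i‖ ≤ 1) (i : Fin 2) : ‖g.mulVec x i‖ ≤ 1 := by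
  rw [Matrix.mulVec, dotProduct, Fin.sum_univ_two]
  refine (Padic.nonarchimedean _ _).trans (max_le ?_ ?_) <;>
    exact (norm_mul _ _).trans_le (mul_le_one₀ (hg _ _) (norm_nonneg _) (hx _))

theorem norm_det_le_one {g : Matrix (Fin 2) (Fin 2) ℚ_[p]} (hg : ∀ i j, ‖g i j‖ ≤ 1) :
    ‖g.det‖ ≤ 1 := by
  rw [Matrix.det_fin_two, sub_eq_add_neg]
  refine (Padic.nonarchimedean _ _).trans (max_le ?_ ?_)
  · exact (norm_mul _ _).trans_le (mul_le_one₀ (hg _ _) (norm_nonneg _) (hg _ _))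
  · rw [norm_neg]
    exact (norm_mul _ _).trans_le (mul_le_one₀ (hg _ _) (norm_nonneg _) (hg _ _))

/-- The stabilizer of the standard lattice is `GL₂(ℤ_p)`. -/
theorem mulVec_image_stdLattice_eq_iff {g : Matrix (Fin 2) (Fin 2) ℚ_[p]} :
    g.mulVec '' (stdLattice p : Set (Fin 2 → ℚ_[p])) = stdLattice p ↔ InGL2Zp g := by
  rw [inGL2Zp_iff_norm]
  have hsingle : ∀ j, (Pi.single j 1 : Fin 2 → ℚ_[p]) ∈ (stdLattice p : Set _) := fun j =>
    Submodule.subset_span ⟨j, rfl⟩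
  constructor
  · intro h
    have hent : ∀ i j, ‖g i j‖ ≤ 1 := fun i j => by
      have hj := h.subset (Set.mem_image_of_mem _ (hsingle j))
      simpa using mem_stdLattice_iff.mp hj i
    choose s hs hgs using fun j => h.superset (hsingle j)
    have hmul : g * (Matrix.of s).transpose = 1 := by
      ext i j
      have := congrFun (hgs j) i
      simpa [Matrix.mul_apply, Matrix.mulVec, dotProduct, Matrix.one_apply,
        Pi.single_apply] using this
    have hdet := congrArg norm (congrArg Matrix.det hmul)
    rw [Matrix.det_mul, Matrix.det_one, norm_mul, norm_one] at hdet
    have hs' : ‖(Matrix.of s).transpose.det‖ ≤ 1 :=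
      norm_det_le_one fun i j => mem_stdLattice_iff.mp (hs j) i
    refine ⟨hent, le_antisymm (norm_det_le_one hent) ?_⟩
    nlinarith [norm_nonneg g.det]
  · rintro ⟨hent, hdet⟩
    refine Set.Subset.antisymm ?_ fun x hx => ?_
    · rintro _ ⟨x, hx, rfl⟩
      exact mem_stdLattice_iff.mpr (norm_mulVec_le_one hent (mem_stdLattice_iff.mp hx))
    · have hne : g.det ≠ 0 := norm_ne_zero_iff.mp (by simp [hdet])
      refine ⟨g⁻¹.mulVec x, mem_stdLattice_iff.mpr
        (norm_mulVec_le_one (fun i j => ?_) (mem_stdLattice_iff.mp hx)), ?_⟩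
      · rw [Matrix.inv_def, Ring.inverse_eq_inv', Matrix.adjugate_fin_two]
        fin_cases i <;> fin_cases j <;> simp [hdet, hent]
      · rw [Matrix.mulVec_mulVec, Matrix.mul_nonsing_inv _ hne.isUnit, Matrix.one_mulVec]

theorem norm_det_eq_of_inGL2Zp_smul {g : Matrix (Fin 2) (Fin 2) ℚ_[p]} {c : ℚ_[p]}
    (hc : c ≠ 0) (h : InGL2Zp (c⁻¹ • g)) : ‖g.det‖ = ‖c‖ ^ 2 := by
  have h' := (inGL2Zp_iff_norm.mp h).2
  rw [Matrix.det_smul, Fintype.card_fin, norm_mul, norm_pow, norm_inv] at h'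
  have := norm_ne_zero_iff.mpr hc
  field_simp at h'
  exact h'

end Lattice

/-- The stabilizer in `GL₂(ℚ_p)` of the privileged ordered edge `(v₀, v₁)` of the
Bruhat–Tits tree is exactly `ℚ_p^×·Γ₀(pℤ_p)`: `g` fixes the homothety classes of both
`Λ₀` and `Λ₁` if and only if `g = ν·t` with `ν ∈ ℚ_p^×` and `t ∈ Γ₀(pℤ_p)`. -/
theorem stabilizer_privileged_edge (p : ℕ) [Fact p.Prime]
    (g : Matrix (Fin 2) (Fin 2) ℚ_[p]) (hg : IsUnit g.det) :
    ((∃ lam : ℚ_[p], lam ≠ 0 ∧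
        g.mulVec '' (stdLattice p : Set (Fin 2 → ℚ_[p])) =
          (fun x => lam • x) '' (stdLattice p : Set (Fin 2 → ℚ_[p]))) ∧
      (∃ μ : ℚ_[p], μ ≠ 0 ∧
        g.mulVec '' (stdLattice' p : Set (Fin 2 → ℚ_[p])) =
          (fun x => μ • x) '' (stdLattice' p : Set (Fin 2 → ℚ_[p])))) ↔
      (∃ (ν : ℚ_[p]) (t : Matrix (Fin 2) (Fin 2) ℚ_[p]),
        ν ≠ 0 ∧ InGamma0 t ∧ g = ν • t) := by
  have hp : (p : ℚ_[p]) ≠ 0 := Nat.cast_ne_zero.mpr (Fact.out : p.Prime).ne_zero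
  set D := Matrix.diagonal ![1, (p : ℚ_[p])] with hD
  set E := Matrix.diagonal ![1, (p : ℚ_[p])⁻¹] with hE
  have hED : E * D = 1 := by
    ext i j
    fin_cases i <;> fin_cases j <;> simp [hE, hD, hp]
  have h₀ : ∀ c : ℚ_[p], c ≠ 0 →
      (g.mulVec '' (stdLattice p : Set (Fin 2 → ℚ_[p])) =
        (fun x => c • x) '' (stdLattice p : Set (Fin 2 → ℚ_[p])) ↔ InGL2Zp (c⁻¹ • g)) := by
    intro c hc
    have h := mulVec_image_eq_smul_image_iff g 1 1 (one_mul 1) hc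
      (stdLattice p : Set (Fin 2 → ℚ_[p]))
    rw [mulVec_image_stdLattice_eq_iff] at h
    simpa using h
  have h₁ : ∀ c : ℚ_[p], c ≠ 0 →
      (g.mulVec '' (stdLattice' p : Set (Fin 2 → ℚ_[p])) =
        (fun x => c • x) '' (stdLattice' p : Set (Fin 2 → ℚ_[p])) ↔
          InGL2Zp (c⁻¹ • (E * g * D))) := by
    intro c hc
    rw [stdLattice'_eq_image, mulVec_image_eq_smul_image_iff g D E hED hc,
      mulVec_image_stdLattice_eq_iff]
  have hdet : ∀ M : Matrix (Fin 2) (Fin 2) ℚ_[p], (E * M * D).det = M.det := by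
    intro M
    have h := congrArg Matrix.det hED
    rw [Matrix.det_mul, Matrix.det_one] at h
    rw [Matrix.det_mul, Matrix.det_mul, mul_right_comm, h, one_mul]
  constructor
  · rintro ⟨⟨c, hc, hgc⟩, d, hd, hgd⟩
    rw [h₀ c hc] at hgc
    rw [h₁ d hd] at hgd
    have hcd : ‖c‖ = ‖d‖ := by
      have h := (norm_det_eq_of_inGL2Zp_smul hc hgc).symm.trans
        (hdet g ▸ norm_det_eq_of_inGL2Zp_smul hd hgd)
      exact (pow_left_inj₀ (norm_nonneg _) (norm_nonneg _) two_ne_zero).mp h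
    refine ⟨c, c⁻¹ • g, hc, ⟨hgc, ?_⟩, (smul_inv_smul₀ hc g).symm⟩
    have h := (inGL2Zp_iff_norm.mp hgd).1 1 0
    have h' : ‖(p : ℚ_[p])⁻¹ * (c⁻¹ * g 1 0)‖ ≤ 1 := by
      simp only [norm_mul, norm_inv, hcd]
      simp [hE, hD] at h
      simpa [mul_left_comm] using h
    exact ⟨⟨_, h'⟩, by simp [hp]⟩
  · rintro ⟨c, t, hc, ⟨ht, x, hx⟩, rfl⟩
    refine ⟨⟨c, hc, (h₀ c hc).mpr ?_⟩, c, hc, (h₁ c hc).mpr ?_⟩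
    · rwa [inv_smul_smul₀ hc]
    · have hconj : c⁻¹ • (E * (c • t) * D) = E * t * D := by
        rw [Matrix.mul_smul, Matrix.smul_mul, inv_smul_smul₀ hc]
      rw [hconj]
      obtain ⟨hent, hunit⟩ := inGL2Zp_iff_norm.mp ht
      refine inGL2Zp_iff_norm.mpr ⟨fun i j => ?_, (hdet t).symm ▸ hunit⟩
      have hp1 : ‖(p : ℚ_[p])‖ ≤ 1 := Padic.norm_p_lt_one.le
      fin_cases i <;> fin_cases j
      · simpa [hE, hD] using hent 0 0
      · simpa [hE, hD] using mul_le_one₀ (hent 0 1) (norm_nonneg _) hp1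
      · simp [hE, hD, hx, hp, PadicInt.norm_le_one]
      · have := hent 1 1
        simpa [hE, hD, mul_right_comm, hp] using this
end

section
/- Let p be a prime, let Γ₀ = Γ₀(pℤ_p) ⊆ GL₂(ℚ_p), and for 0 ≤ i ≤ p−1 let αᵢ denote the matrix [[p, i],[0, 1]] ∈ GL₂(ℚ_p). Then the double coset Γ₀·α₀·Γ₀ is equal to the union over i = 0,…,p−1 of the left cosets αᵢ·Γ₀, and these p left cosets are pairwise disjoint. -/
/-- The matrix `αᵢ = [[p, i],[0, 1]] ∈ GL₂(ℚ_p)`. -/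
noncomputable def UpRep (p : ℕ) [Fact p.Prime] (i : ℕ) : Matrix (Fin 2) (Fin 2) ℚ_[p] :=
  !![(p : ℚ_[p]), (i : ℚ_[p]); 0, 1]

theorem inGamma0_iff {p : ℕ} [Fact p.Prime] {g : Matrix (Fin 2) (Fin 2) ℚ_[p]} :
    InGamma0 g ↔ ∃ a b c d : ℤ_[p], IsUnit (a * d - p * b * c) ∧
      g = !![(a : ℚ_[p]), (b : ℚ_[p]); (p : ℚ_[p]) * (c : ℚ_[p]), (d : ℚ_[p])] := by
  constructor
  · rintro ⟨⟨hint, u, hu⟩, c, hc⟩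
    obtain ⟨a, ha⟩ := hint 0 0
    obtain ⟨b, hb⟩ := hint 0 1
    obtain ⟨d, hd⟩ := hint 1 1
    refine ⟨a, b, c, d, ?_, ?_⟩
    · have h : (u : ℤ_[p]) = a * d - p * b * c := by
        apply Subtype.coe_injective
        push_cast
        rw [hu, Matrix.det_fin_two, ← ha, ← hb, hc, ← hd]
        ring
      exact h ▸ u.isUnit
    · rw [ha, hb, ← hc, hd]
      exact Matrix.eta_fin_two g
  · rintro ⟨a, b, c, d, ⟨u, hu⟩, rfl⟩
    refine ⟨⟨fun i j => ?_, u, ?_⟩, c, rfl⟩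
    · fin_cases i <;> fin_cases j
      exacts [⟨a, rfl⟩, ⟨b, rfl⟩, ⟨p * c, by simp⟩, ⟨d, rfl⟩]
    · rw [hu, Matrix.det_fin_two_of]
      push_cast
      ring

theorem InGamma0.mul {p : ℕ} [Fact p.Prime] {g h : Matrix (Fin 2) (Fin 2) ℚ_[p]}
    (hg : InGamma0 g) (hh : InGamma0 h) : InGamma0 (g * h) := by
  obtain ⟨a, b, c, d, hu, rfl⟩ := inGamma0_iff.1 hg
  obtain ⟨a', b', c', d', hu', rfl⟩ := inGamma0_iff.1 hh
  refine inGamma0_iff.2 ⟨a * a' + p * b * c', a * b' + b * d', c * a' + d * c',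
    p * c * b' + d * d', ?_, ?_⟩
  · convert hu.mul hu' using 1
    ring
  · rw [Matrix.mul_fin_two]
    push_cast
    ext k l
    fin_cases k <;> fin_cases l <;> dsimp <;> ring

theorem PadicInt.isUnit_of_isUnit_sub_prime_mul {p : ℕ} [Fact p.Prime] {x y : ℤ_[p]}
    (h : IsUnit (x - p * y)) : IsUnit x := by
  by_contra hx
  have hx' : x ∈ IsLocalRing.maximalIdeal ℤ_[p] := hx
  have hp : (p : ℤ_[p]) ∈ IsLocalRing.maximalIdeal ℤ_[p] := PadicInt.prime_p.not_isUnit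
  exact (IsLocalRing.mem_maximalIdeal _).1 (sub_mem hx' (Ideal.mul_mem_right y _ hp)) h

theorem isUnit_of_isUnit_det {p : ℕ} [Fact p.Prime] {a b c d : ℤ_[p]}
    (h : IsUnit (a * d - p * b * c)) : IsUnit d := by
  rw [mul_assoc] at h
  exact isUnit_of_mul_isUnit_right (PadicInt.isUnit_of_isUnit_sub_prime_mul h)

theorem PadicInt.exists_lt_eq_prime_mul (p : ℕ) [Fact p.Prime] (x : ℤ_[p]) :
    ∃ i < p, ∃ t : ℤ_[p], x - i = p * t := by
  refine ⟨x.zmodRepr, x.zmodRepr_lt_p, ?_⟩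
  have h := x.sub_zmodRepr_mem
  rwa [PadicInt.maximalIdeal_eq_span_p, Ideal.mem_span_singleton] at h

theorem InGamma0.exists_mul_upRep_zero_eq {p : ℕ} [Fact p.Prime]
    {g : Matrix (Fin 2) (Fin 2) ℚ_[p]} (hg : InGamma0 g) :
    ∃ i < p, ∃ h, InGamma0 h ∧ g * UpRep p 0 = UpRep p i * h := by
  obtain ⟨a, b, c, d, hu, rfl⟩ := inGamma0_iff.1 hg
  obtain ⟨e, he⟩ := (isUnit_of_isUnit_det hu).exists_right_inv
  obtain ⟨i, hi, t, ht⟩ := PadicInt.exists_lt_eq_prime_mul p (b * e)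
  have hb : b = p * (t * d) + i * d := by linear_combination d * ht - b * he
  refine ⟨i, hi, _, inGamma0_iff.2 ⟨a - i * p * c, t * d, p * c, d, ?_, rfl⟩, ?_⟩
  · convert hu using 1
    rw [hb]
    ring
  · rw [hb, UpRep, UpRep, Matrix.mul_fin_two, Matrix.mul_fin_two]
    push_cast
    ext k l
    fin_cases k <;> fin_cases l <;> dsimp <;> ring

theorem upRep_eq_mul_upRep_zero (p : ℕ) [Fact p.Prime] (i : ℕ) :
    ∃ g, InGamma0 g ∧ UpRep p i = g * UpRep p 0 := by
  refine ⟨_, inGamma0_iff.2 ⟨1, i, 0, 1, by simp, rfl⟩, ?_⟩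
  simp [UpRep]

theorem eq_of_upRep_mul_eq {p : ℕ} [Fact p.Prime] {i j : ℕ} (hi : i < p) (hj : j < p)
    {g h : Matrix (Fin 2) (Fin 2) ℚ_[p]} (hg : InGamma0 g) (hh : InGamma0 h)
    (heq : UpRep p i * g = UpRep p j * h) : i = j := by
  obtain ⟨a, b, c, d, hu, rfl⟩ := inGamma0_iff.1 hg
  obtain ⟨a', b', c', d', -, rfl⟩ := inGamma0_iff.1 hh
  rw [UpRep, UpRep, Matrix.mul_fin_two, Matrix.mul_fin_two] at heq
  have h₀ : (p : ℚ_[p]) * b + i * d = p * b' + j * d' := congrFun₂ heq 0 1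
  have h₁ : (0 : ℚ_[p]) * b + 1 * d = 0 * b' + 1 * d' := congrFun₂ heq 1 1
  have hd : d = d' := Subtype.coe_injective (by linear_combination h₁)
  subst hd
  have h₂ : (p : ℤ_[p]) * b + i * d = p * b' + j * d :=
    Subtype.coe_injective (by push_cast; exact h₀)
  obtain ⟨e, he⟩ := (isUnit_of_isUnit_det hu).exists_right_inv
  have hmem : (i : ℤ_[p]) - j ∈ IsLocalRing.maximalIdeal ℤ_[p] := by
    rw [PadicInt.maximalIdeal_eq_span_p, Ideal.mem_span_singleton]
    exact ⟨(b' - b) * e, by linear_combination e * h₂ - (i - j) * he⟩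
  rw [← PadicInt.zmodRepr_natCast_of_lt hi, PadicInt.zmodRepr_unique _ j hj hmem]

/-- The double coset `Γ₀·α₀·Γ₀` decomposes as the disjoint union of the left cosets
`αᵢ·Γ₀` for `i = 0, …, p−1`, where `αᵢ = [[p, i],[0, 1]]`.  This is the coset
decomposition defining the Hecke operator `U_p`. -/
theorem up_double_coset_decomposition (p : ℕ) [Fact p.Prime] :
    ({x : Matrix (Fin 2) (Fin 2) ℚ_[p] | ∃ g₁ g₂, InGamma0 g₁ ∧ InGamma0 g₂ ∧
        x = g₁ * UpRep p 0 * g₂} =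
      ⋃ i ∈ Finset.range p,
        {x : Matrix (Fin 2) (Fin 2) ℚ_[p] | ∃ g, InGamma0 g ∧ x = UpRep p i * g}) ∧
    ∀ i j : ℕ, i < p → j < p → i ≠ j →
      Disjoint
        {x : Matrix (Fin 2) (Fin 2) ℚ_[p] | ∃ g, InGamma0 g ∧ x = UpRep p i * g}
        {x : Matrix (Fin 2) (Fin 2) ℚ_[p] | ∃ g, InGamma0 g ∧ x = UpRep p j * g} := by
  refine ⟨Set.ext fun x => ?_, fun i j hi hj hij => Set.disjoint_left.2 ?_⟩
  · simp only [Set.mem_ofPred_eq, Set.mem_iUnion, Finset.mem_range, exists_prop]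
    constructor
    · rintro ⟨g₁, g₂, hg₁, hg₂, rfl⟩
      obtain ⟨i, hi, h, hh, heq⟩ := hg₁.exists_mul_upRep_zero_eq
      exact ⟨i, hi, h * g₂, hh.mul hg₂, by rw [heq, mul_assoc]⟩
    · rintro ⟨i, -, g, hg, rfl⟩
      obtain ⟨g₁, hg₁, heq⟩ := upRep_eq_mul_upRep_zero p i
      exact ⟨g₁, g, hg₁, hg, by rw [heq]⟩
  · rintro _ ⟨g, hg, rfl⟩ ⟨h, hh, heq⟩
    exact hij (eq_of_upRep_mul_eq hi hj hg hh heq)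
end
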